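/- arXiv:2110.07042 — 3 statements merged into one kernel-verified Lean document; each statement's English description precedes it below -/
import Mathlib

section
/- Let p = (p_0,…,p_n) be a probability vector with all p_i > 0, and for 0 ≤ k ≠ l ≤ n define the operator ρ_p(e_{kl}) on functions f: Ω_{2j} → ℂ by (ρ_p(e_{kl})f)(ξ) = √(p_k/p_l) · ξ_l · f(ξ − e_l + e_k). Then for all 0 ≤ k ≠ l ≤ n and all f,g: Ω_{2j} → ℂ, (ρ_p(e_{kl})f, g)_p = (f, ρ_p(e_{lk})g)_p, where (f,g)_p = Σ_{ξ∈Ω_{2j}} f(ξ) \overline{g(ξ)} w_p(ξ). That is, ρ_p respects the *-structure e_{kl}* = e_{lk} of sl_{n+1} on l²(w_p). -/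
/-- The state space `Ω_{2j}`; `m` plays the role of `2j`. -/
def Omega (n m : ℕ) : Finset (Fin (n + 1) → ℕ) :=
  Finset.Nat.antidiagonalTuple (n + 1) m

/-- `conf ξ k l = ξ + e_k − e_l` (truncated subtraction on ℕ). -/
def conf {d : ℕ} (ξ : Fin d → ℕ) (k l : Fin d) : Fin d → ℕ :=
  fun i => (if i = k then ξ i + 1 else ξ i) - (if i = l then 1 else 0)

/-- Multinomial weight `w_p(ξ)`. -/
noncomputable def wp {d : ℕ} (m : ℕ) (p : Fin d → ℝ) (ξ : Fin d → ℕ) : ℝ :=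
  ((Nat.factorial m : ℝ) / ∏ i, (Nat.factorial (ξ i) : ℝ)) * ∏ i, p i ^ ξ i

/-- The representation `ρ_p(e_{kl})f(ξ) = √(p_k/p_l) ξ_l f(ξ − e_l + e_k)`. -/
noncomputable def rhoP (n : ℕ) (p : Fin (n + 1) → ℝ) (k l : Fin (n + 1))
    (f : (Fin (n + 1) → ℕ) → ℂ) (ξ : Fin (n + 1) → ℕ) : ℂ :=
  (Real.sqrt (p k / p l) : ℂ) * (ξ l : ℂ) * f (conf ξ k l)

theorem wp_step {d : ℕ} (m : ℕ) (p : Fin d → ℝ) (ζ ξ : Fin d → ℕ) (l : Fin d)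
    (h : ξ l = ζ l + 1) (h' : ∀ i, i ≠ l → ξ i = ζ i) :
    (ξ l : ℝ) * wp m p ξ = p l * wp m p ζ := by
  unfold wp
  rw [← Finset.mul_prod_erase Finset.univ (fun i => (Nat.factorial (ξ i) : ℝ)) (Finset.mem_univ l),
    ← Finset.mul_prod_erase Finset.univ (fun i => (Nat.factorial (ζ i) : ℝ)) (Finset.mem_univ l),
    ← Finset.mul_prod_erase Finset.univ (fun i => p i ^ ξ i) (Finset.mem_univ l),
    ← Finset.mul_prod_erase Finset.univ (fun i => p i ^ ζ i) (Finset.mem_univ l)]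
  have e1 : ∏ i ∈ Finset.univ.erase l, (Nat.factorial (ξ i) : ℝ)
      = ∏ i ∈ Finset.univ.erase l, (Nat.factorial (ζ i) : ℝ) :=
    Finset.prod_congr rfl fun i hi => by rw [h' i (Finset.ne_of_mem_erase hi)]
  have e2 : ∏ i ∈ Finset.univ.erase l, p i ^ ξ i
      = ∏ i ∈ Finset.univ.erase l, p i ^ ζ i :=
    Finset.prod_congr rfl fun i hi => by rw [h' i (Finset.ne_of_mem_erase hi)]
  have e3 : ∏ i ∈ Finset.univ.erase l, (Nat.factorial (ζ i) : ℝ) ≠ 0 :=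
    Finset.prod_ne_zero_iff.2 fun i _ => by positivity
  rw [e1, e2, h, Nat.factorial_succ]
  have e4 : (Nat.factorial (ζ l) : ℝ) ≠ 0 := by positivity
  push_cast
  have e5 : (ζ l : ℝ) + 1 ≠ 0 := by positivity
  field_simp
  ring

theorem wp_conf {d : ℕ} (m : ℕ) (p : Fin d → ℝ) (hp : ∀ i, 0 < p i) (ξ : Fin d → ℕ)
    (k l : Fin d) (hkl : k ≠ l) (h : ξ l ≠ 0) :
    Real.sqrt (p k / p l) * ξ l * wp m p ξ
      = Real.sqrt (p l / p k) * (conf ξ k l k) * wp m p (conf ξ k l) := by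
  let ζ : Fin d → ℕ := fun i => if i = l then ξ i - 1 else ξ i
  have h1 : (ξ l : ℝ) * wp m p ξ = p l * wp m p ζ := by
    apply wp_step
    · simp only [ζ, if_true]; omega
    · intro i hi; simp [ζ, hi]
  have h2 : (conf ξ k l k : ℝ) * wp m p (conf ξ k l) = p k * wp m p ζ := by
    apply wp_step
    · simp [ζ, conf, hkl]
    · intro i hi
      simp only [ζ, conf, hi, if_false]
      split_ifs <;> rfl
  rw [mul_assoc, mul_assoc, h1, h2, Real.sqrt_div (hp k).le, Real.sqrt_div (hp l).le]
  have hk := Real.sqrt_pos.2 (hp k)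
  have hl := Real.sqrt_pos.2 (hp l)
  have sk := Real.sq_sqrt (hp k).le
  have sl := Real.sq_sqrt (hp l).le
  generalize Real.sqrt (p k) = a at *
  generalize Real.sqrt (p l) = b at *
  rw [← sk, ← sl]
  field_simp

theorem conf_conf {d : ℕ} (ξ : Fin d → ℕ) (k l : Fin d) (hkl : k ≠ l) (h : ξ l ≠ 0) :
    conf (conf ξ k l) l k = ξ := by
  funext i
  unfold conf
  by_cases hk : i = k
  · subst hk; simp [hkl]
  · by_cases hl : i = l
    · subst hl; simp [hk]; omega
    · simp [hk, hl]

theorem conf_mem {n m : ℕ} (ξ : Fin (n + 1) → ℕ) (k l : Fin (n + 1)) (hkl : k ≠ l) (h : ξ l ≠ 0)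
    (hm : ξ ∈ Omega n m) : conf ξ k l ∈ Omega n m := by
  unfold Omega at *
  rw [Finset.Nat.mem_antidiagonalTuple] at *
  have e : ∀ i, conf ξ k l i + (if i = l then 1 else 0) = ξ i + (if i = k then 1 else 0) := by
    intro i
    unfold conf
    by_cases hk : i = k
    · subst hk; simp [hkl]
    · by_cases hl : i = l
      · subst hl; simp [hk]; omega
      · simp [hk, hl]
  have := Finset.sum_congr (rfl : (Finset.univ : Finset (Fin (n + 1))) = _) fun i _ => e i
  simp only [Finset.sum_add_distrib, Finset.sum_ite_eq', Finset.mem_univ, if_true] at this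
  omega

theorem conf_apply_ne {d : ℕ} (ξ : Fin d → ℕ) (k l : Fin d) (hkl : k ≠ l) :
    conf ξ k l k ≠ 0 := by
  simp [conf, hkl]

/-- `ρ_p` respects the `*`-structure `e_{kl}* = e_{lk}` of `sl_{n+1}` on `l²(w_p)`:
`(ρ_p(e_{kl})f, g)_p = (f, ρ_p(e_{lk})g)_p`. -/
theorem rhoP_star_representation (n m : ℕ) (hn : 1 ≤ n) (hm : 0 < m)
    (p : Fin (n + 1) → ℝ) (hp : ∀ i, 0 < p i) (hp1 : ∑ i, p i = 1)
    (k l : Fin (n + 1)) (hkl : k ≠ l) (f g : (Fin (n + 1) → ℕ) → ℂ) :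
    ∑ ξ ∈ Omega n m, rhoP n p k l f ξ * (starRingEnd ℂ) (g ξ) * (wp m p ξ : ℂ) =
      ∑ ξ ∈ Omega n m, f ξ * (starRingEnd ℂ) (rhoP n p l k g ξ) * (wp m p ξ : ℂ) := by
  have L : ∑ ξ ∈ (Omega n m).filter (fun ξ => ξ l ≠ 0),
      rhoP n p k l f ξ * (starRingEnd ℂ) (g ξ) * (wp m p ξ : ℂ) =
      ∑ ξ ∈ Omega n m, rhoP n p k l f ξ * (starRingEnd ℂ) (g ξ) * (wp m p ξ : ℂ) := by
    apply Finset.sum_filter_of_ne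
    intro ξ _ h h0
    exact h (by simp [rhoP, h0])
  have R : ∑ ξ ∈ (Omega n m).filter (fun ξ => ξ k ≠ 0),
      f ξ * (starRingEnd ℂ) (rhoP n p l k g ξ) * (wp m p ξ : ℂ) =
      ∑ ξ ∈ Omega n m, f ξ * (starRingEnd ℂ) (rhoP n p l k g ξ) * (wp m p ξ : ℂ) := by
    apply Finset.sum_filter_of_ne
    intro ξ _ h h0
    exact h (by simp [rhoP, h0])
  rw [← L, ← R]
  refine Finset.sum_bij' (fun ξ _ => conf ξ k l) (fun ξ _ => conf ξ l k) ?_ ?_ ?_ ?_ ?_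
  · intro ξ h
    rw [Finset.mem_filter] at *
    exact ⟨conf_mem ξ k l hkl h.2 h.1, conf_apply_ne ξ k l hkl⟩
  · intro ξ h
    rw [Finset.mem_filter] at *
    exact ⟨conf_mem ξ l k hkl.symm h.2 h.1, conf_apply_ne ξ l k hkl.symm⟩
  · intro ξ h
    exact conf_conf ξ k l hkl (Finset.mem_filter.1 h).2
  · intro ξ h
    exact conf_conf ξ l k hkl.symm (Finset.mem_filter.1 h).2
  · intro ξ h
    have h0 := (Finset.mem_filter.1 h).2
    have key := congrArg (fun x : ℝ => (x : ℂ)) (wp_conf m p hp ξ k l hkl h0)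
    simp only [Complex.ofReal_mul, Complex.ofReal_natCast] at key
    simp only [rhoP, conf_conf ξ k l hkl h0, map_mul, Complex.conj_ofReal, map_natCast]
    linear_combination (f (conf ξ k l) * (starRingEnd ℂ) (g ξ)) * key
end

section
/- Let κ = (ν,P,P̂,U) ∈ K_n with U a real matrix and with p = (p_0,…,p_n) and p̂ = (p̂_0,…,p̂_n) probability vectors with all entries positive. Let θ̂ ≠ 0 be real, R = θ̂ P̂ Uᵀ = (r_{kl}), Q = R^{−1} = (q_{kl}), and for 0 ≤ i ≠ m ≤ n define the operator σ_p(e_{im}) on functions f: Ω_{2j} → ℝ by (σ_p(e_{im})f)(η) = √(p̂_i/p̂_m) Σ_{k,l=0}^n q_{ki} r_{ml} η_l f(η + e_k − e_l). Then for all 0 ≤ i ≠ m ≤ n and all f,g: Ω_{2j} → ℝ, (σ_p(e_{im})f, g)_p = (f, σ_p(e_{mi})g)_p, where (f,g)_p = Σ_{η∈Ω_{2j}} f(η) g(η) w_p(η). That is, σ_p respects the *-structure e_{im}* = e_{mi} of sl_{n+1} on l²(w_p). -/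
/-- The matrix `R = θ̂ P̂ Uᵀ`. -/
noncomputable def Rmat (n : ℕ) (θ : ℝ) (phat : Fin (n + 1) → ℝ)
    (U : Matrix (Fin (n + 1)) (Fin (n + 1)) ℝ) : Matrix (Fin (n + 1)) (Fin (n + 1)) ℝ :=
  θ • (Matrix.diagonal phat * U.transpose)

/-- The operator `σ_p(e_{im})f(η) = √(p̂_i/p̂_m) Σ_{k,l} q_{ki} r_{ml} η_l f(η + e_k − e_l)`,
where `R = θ̂ P̂ Uᵀ = (r_{kl})` and `Q = R⁻¹ = (q_{kl})`. -/
noncomputable def sigmaOp (n : ℕ) (θ : ℝ) (phat : Fin (n + 1) → ℝ)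
    (U : Matrix (Fin (n + 1)) (Fin (n + 1)) ℝ) (i m' : Fin (n + 1))
    (f : (Fin (n + 1) → ℕ) → ℝ) (η : Fin (n + 1) → ℕ) : ℝ :=
  Real.sqrt (phat i / phat m') *
    ∑ k : Fin (n + 1), ∑ l : Fin (n + 1),
      (Rmat n θ phat U)⁻¹ k i * Rmat n θ phat U m' l * (η l : ℝ) * f (conf η k l)

theorem wp_add_single {d : ℕ} (m : ℕ) (p : Fin d → ℝ) (ζ : Fin d → ℕ) (l : Fin d) :
    (((ζ + Pi.single l 1 : Fin d → ℕ) l : ℕ) : ℝ) * wp m p (ζ + Pi.single l 1) = p l * wp m p ζ := by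
  have h1 : ∏ i, (Nat.factorial ((ζ + Pi.single l 1 : Fin d → ℕ) i) : ℝ)
      = ((ζ l : ℝ) + 1) * ∏ i, (Nat.factorial (ζ i) : ℝ) := by
    rw [← Finset.mul_prod_erase _ _ (Finset.mem_univ l),
      ← Finset.mul_prod_erase _ (fun i => (Nat.factorial (ζ i) : ℝ)) (Finset.mem_univ l),
      ← mul_assoc]
    congr 1
    · simp [Nat.factorial_succ]
    · apply Finset.prod_congr rfl
      intro x hx
      simp [Finset.ne_of_mem_erase hx]
  have h2 : ∏ i, p i ^ ((ζ + Pi.single l 1 : Fin d → ℕ) i) = p l * ∏ i, p i ^ ζ i := by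
    rw [← Finset.mul_prod_erase _ _ (Finset.mem_univ l),
      ← Finset.mul_prod_erase _ (fun i => p i ^ ζ i) (Finset.mem_univ l),
      ← mul_assoc]
    congr 1
    · simp [pow_succ, mul_comm]
    · apply Finset.prod_congr rfl
      intro x hx
      simp [Finset.ne_of_mem_erase hx]
  have h3 : ∏ i, (Nat.factorial (ζ i) : ℝ) ≠ 0 :=
    Finset.prod_ne_zero_iff.mpr fun i _ => by positivity
  have h4 : (ζ l : ℝ) + 1 ≠ 0 := by positivity
  unfold wp
  rw [h1, h2]
  simp only [Pi.add_apply, Pi.single_eq_same, Nat.cast_add, Nat.cast_one]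
  field_simp

theorem sum_shift (n M : ℕ) (p : Fin (n + 1) → ℝ) (l : Fin (n + 1))
    (F : (Fin (n + 1) → ℕ) → ℝ) :
    ∑ ζ ∈ Omega n M, p l * wp (M + 1) p ζ * F (ζ + Pi.single l 1) =
      ∑ η ∈ Omega n (M + 1), (η l : ℝ) * wp (M + 1) p η * F η := by
  apply Finset.sum_of_injOn (fun ζ => ζ + Pi.single l 1)
  · intro a _ b _ h
    exact add_right_cancel h
  · intro a ha
    simp only [Omega, Finset.mem_coe, Finset.Nat.mem_antidiagonalTuple] at ha ⊢
    simp [Finset.sum_add_distrib, ha]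
  · intro η hη hne
    have : η l = 0 := by
      by_contra h0
      apply hne
      have hz : η - Pi.single l 1 + Pi.single l 1 = η := by
        funext x
        by_cases hx : x = l
        · subst hx
          simp
          omega
        · simp [hx]
      refine ⟨η - Pi.single l 1, ?_, hz⟩
      simp only [Omega, Finset.mem_coe, Finset.Nat.mem_antidiagonalTuple] at hη ⊢
      rw [← hz] at hη
      simp only [Pi.add_apply, Finset.sum_add_distrib] at hη
      simpa using hη
    simp [this]
  · intro ζ _
    rw [wp_add_single]

theorem conf_add_single {d : ℕ} (ζ : Fin d → ℕ) (k l : Fin d) :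
    conf (ζ + Pi.single l 1) k l = ζ + Pi.single k 1 := by
  funext x
  simp only [conf, Pi.add_apply, Pi.single_apply]
  split_ifs <;> omega

theorem sum_swap (n m : ℕ) (hm : 0 < m) (p : Fin (n + 1) → ℝ) (k l : Fin (n + 1))
    (f g : (Fin (n + 1) → ℕ) → ℝ) :
    p k * ∑ η ∈ Omega n m, (η l : ℝ) * wp m p η * (f (conf η k l) * g η) =
      p l * ∑ η ∈ Omega n m, (η k : ℝ) * wp m p η * (g (conf η l k) * f η) := by
  obtain ⟨M, rfl⟩ : ∃ M, m = M + 1 := ⟨m - 1, by omega⟩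
  rw [← sum_shift n M p l (fun η => f (conf η k l) * g η),
    ← sum_shift n M p k (fun η => g (conf η l k) * f η), Finset.mul_sum, Finset.mul_sum]
  apply Finset.sum_congr rfl
  intro ζ _
  simp only [conf_add_single]
  ring

theorem sigmaOp_eq (n : ℕ) (ν : ℝ) (p phat : Fin (n + 1) → ℝ)
    (U : Matrix (Fin (n + 1)) (Fin (n + 1)) ℝ)
    (hmain : ν • (Matrix.diagonal p * U * Matrix.diagonal phat * U.transpose) = 1)
    (hphat : ∀ i, 0 < phat i) (θ : ℝ) (hθ : θ ≠ 0) (i j : Fin (n + 1))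
    (f : (Fin (n + 1) → ℕ) → ℝ) (η : Fin (n + 1) → ℕ) :
    sigmaOp n θ phat U i j f η = Real.sqrt (phat i * phat j) * ν *
      ∑ k, ∑ l, p k * U k i * U l j * (η l : ℝ) * f (conf η k l) := by
  have hQ : (Rmat n θ phat U)⁻¹ = (ν / θ) • (Matrix.diagonal p * U) := by
    apply Matrix.inv_eq_left_inv
    rw [Rmat, Matrix.smul_mul, Matrix.mul_smul, smul_smul, div_mul_cancel₀ _ hθ, ← hmain]
    simp only [Matrix.mul_assoc]
  have hs : Real.sqrt (phat i / phat j) * phat j = Real.sqrt (phat i * phat j) := by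
    have hj := hphat j
    nth_rewrite 2 [← Real.sqrt_sq hj.le]
    rw [← Real.sqrt_mul (div_pos (hphat i) hj).le]
    congr 1
    field_simp
  unfold sigmaOp
  rw [← hs, hQ, Finset.mul_sum, Finset.mul_sum]
  apply Finset.sum_congr rfl
  intro k _
  rw [Finset.mul_sum, Finset.mul_sum]
  apply Finset.sum_congr rfl
  intro l _
  simp only [Rmat, Matrix.smul_apply, Matrix.diagonal_mul, Matrix.transpose_apply, smul_eq_mul]
  field_simp

theorem sum_sigma (n m : ℕ) (c : ℝ) (p a b : Fin (n + 1) → ℝ)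
    (f g : (Fin (n + 1) → ℕ) → ℝ) :
    ∑ η ∈ Omega n m, (c * ∑ k, ∑ l, p k * a k * b l * (η l : ℝ) * f (conf η k l)) *
        g η * wp m p η =
      c * ∑ k, ∑ l, a k * b l *
        (p k * ∑ η ∈ Omega n m, (η l : ℝ) * wp m p η * (f (conf η k l) * g η)) := by
  simp only [Finset.mul_sum, Finset.sum_mul]
  rw [Finset.sum_comm]
  apply Finset.sum_congr rfl
  intro k _
  rw [Finset.sum_comm]
  apply Finset.sum_congr rfl
  intro l _
  apply Finset.sum_congr rfl
  intro η _
  ring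

/-- For a real 4-tuple `(ν,P,P̂,U) ∈ K_n` with `p`, `p̂` positive probability vectors,
the representation `σ_p` respects the `*`-structure `e_{im}* = e_{mi}` of `sl_{n+1}`
on `l²(w_p)`. -/
theorem sigmaOp_star_representation (n m : ℕ) (hn : 1 ≤ n) (hm : 0 < m)
    (ν : ℝ) (hν : ν ≠ 0) (p phat : Fin (n + 1) → ℝ)
    (U : Matrix (Fin (n + 1)) (Fin (n + 1)) ℝ)
    (hp0 : p 0 = 1 / ν) (hphat0 : phat 0 = 1 / ν)
    (hU0 : ∀ k, U k 0 = 1 ∧ U 0 k = 1)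
    (hmain : ν • (Matrix.diagonal p * U * Matrix.diagonal phat * U.transpose) = 1)
    (hp : ∀ i, 0 < p i) (hp1 : ∑ i, p i = 1)
    (hphat : ∀ i, 0 < phat i) (hphat1 : ∑ i, phat i = 1)
    (θ : ℝ) (hθ : θ ≠ 0) :
    ∀ i m' : Fin (n + 1), i ≠ m' → ∀ f g : (Fin (n + 1) → ℕ) → ℝ,
      ∑ η ∈ Omega n m, sigmaOp n θ phat U i m' f η * g η * wp m p η =
        ∑ η ∈ Omega n m, f η * sigmaOp n θ phat U m' i g η * wp m p η := by
  intro i j _ f g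
  simp only [sigmaOp_eq n ν p phat U hmain hphat θ hθ]
  simp only [mul_comm (f _) (_ * _)]
  rw [sum_sigma n m _ p (fun k => U k i) (fun l => U l j) f g,
    sum_sigma n m _ p (fun k => U k j) (fun l => U l i) g f, mul_comm (phat j) (phat i)]
  congr 1
  rw [Finset.sum_comm]
  apply Finset.sum_congr rfl
  intro l _
  apply Finset.sum_congr rfl
  intro k _
  rw [sum_swap n m hm p k l f g]
  ring
end

section
/- Let G=(V,E) be a finite undirected graph, n ≥ 1 and λ > 0. Define D(ξ,η) = Π_{x∈V} C(ξ^x, η^x, λ) for configurations ξ, η ∈ (ℕ^n)^V, where C(ξ^x,η^x,λ) = Π_{i=1}^n e^λ C_{ξ_i^x}(η_i^x,λ). Then the n-species IRW on G is self-dual with duality function D at the level of generators: for all ξ, η ∈ (ℕ^n)^V, [L D(·,η)](ξ) = [L D(ξ,·)](η), where L is the generator of the n-species IRW. -/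
/-- The Charlier polynomial `C_m(z,λ) = Σ_{k=0}^m (−1)^k C(m,k) C(z,k) k! λ^{−k}`. -/
noncomputable def charlier (lam : ℝ) (m z : ℕ) : ℝ :=
  ∑ k ∈ Finset.range (m + 1),
    (-1 : ℝ) ^ k * (Nat.choose m k : ℝ) * (Nat.choose z k : ℝ) * (Nat.factorial k : ℝ) /
      lam ^ k

/-- `C(ξ,η,λ) = ∏_{i=1}^n e^λ C_{ξ_i}(η_i,λ)`. -/
noncomputable def charlierProd (n : ℕ) (lam : ℝ) (ξ η : Fin n → ℕ) : ℝ :=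
  ∏ i, Real.exp lam * charlier lam (ξ i) (η i)

/-- The configuration `ξ_i^{x,y}`: one species-`i` particle is moved from site `x`
to site `y`. -/
def irwMove {V : Type*} [DecidableEq V] {n : ℕ} (ζ : V → Fin n → ℕ) (x y : V)
    (i : Fin n) : V → Fin n → ℕ :=
  fun v r => (if v = y ∧ r = i then ζ v r + 1 else ζ v r) - (if v = x ∧ r = i then 1 else 0)

/-- Single-edge generator `L_{x,y}` of the `n`-species independent random walker. -/
noncomputable def irwEdge {V : Type*} [DecidableEq V] {n : ℕ} (x y : V)
    (f : (V → Fin n → ℕ) → ℝ) (ζ : V → Fin n → ℕ) : ℝ :=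
  ∑ i : Fin n,
    ((ζ x i : ℝ) * (f (irwMove ζ x y i) - f ζ) + (ζ y i : ℝ) * (f (irwMove ζ y x i) - f ζ))

/-- Generator of the `n`-species IRW on a finite undirected graph whose edges are listed
(in an arbitrary orientation, which is irrelevant since `L_{x,y} = L_{y,x}`). -/
noncomputable def irwGen {V : Type*} [DecidableEq V] {n : ℕ} (E : Finset (V × V))
    (f : (V → Fin n → ℕ) → ℝ) (ζ : V → Fin n → ℕ) : ℝ :=
  ∑ e ∈ E, irwEdge e.1 e.2 f ζ

theorem charlier_eq_range (lam : ℝ) (m z N : ℕ) (h : m ≤ N) :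
    charlier lam m z = ∑ k ∈ Finset.range (N + 1),
      (-1 : ℝ) ^ k * (Nat.choose m k : ℝ) * (Nat.choose z k : ℝ) * (Nat.factorial k : ℝ) /
        lam ^ k := by
  unfold charlier
  apply Finset.sum_subset
  · intro k hk
    simp only [Finset.mem_range] at *
    omega
  · intro k _ hk
    simp only [Finset.mem_range, not_lt] at hk
    rw [Nat.choose_eq_zero_of_lt (by omega : m < k)]
    simp

theorem charlier_symm (lam : ℝ) (m z : ℕ) : charlier lam m z = charlier lam z m := by
  rw [charlier_eq_range lam m z (m + z) (by omega), charlier_eq_range lam z m (m + z) (by omega)]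
  apply Finset.sum_congr rfl
  intro k _
  ring

theorem charlier_zero_right (lam : ℝ) (m : ℕ) : charlier lam m 0 = 1 := by
  rw [charlier_symm]
  simp [charlier]

theorem charlier_succ_succ (lam : ℝ) (hl : lam ≠ 0) (m z : ℕ) :
    lam * charlier lam (m + 1) (z + 1) =
      lam * charlier lam m (z + 1) - ((z : ℝ) + 1) * charlier lam m z := by
  rw [charlier_eq_range lam m (z + 1) (m + 1) (by omega)]
  unfold charlier
  rw [Finset.sum_range_succ' _ (m + 1), Finset.sum_range_succ' _ (m + 1)]
  simp only [mul_add, Finset.mul_sum]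
  rw [add_sub_right_comm, ← Finset.sum_sub_distrib]
  congr 1
  · apply Finset.sum_congr rfl
    intro k _
    have h1 : ((Nat.choose (m + 1) (k + 1) : ℕ) : ℝ) = Nat.choose m k + Nat.choose m (k + 1) := by
      rw [Nat.choose_succ_succ]; push_cast; ring
    have h2 : ((z : ℝ) + 1) * Nat.choose z k = Nat.choose (z + 1) (k + 1) * ((k : ℝ) + 1) := by
      exact_mod_cast Nat.add_one_mul_choose_eq z k
    rw [h1, Nat.factorial_succ]
    push_cast
    have h3 : ((z : ℝ) + 1) * ((-1) ^ k * (Nat.choose m k : ℝ) * (Nat.choose z k : ℝ)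
        * (Nat.factorial k : ℝ) / lam ^ k) = (-1) ^ k * (Nat.choose m k : ℝ) *
        (Nat.choose (z + 1) (k + 1) * ((k : ℝ) + 1)) * (Nat.factorial k : ℝ) / lam ^ k := by
      rw [← h2]; ring
    rw [h3]
    field_simp
    ring
  · simp

theorem charlier_up_left (lam : ℝ) (hl : lam ≠ 0) (m z : ℕ) :
    lam * charlier lam (m + 1) z =
      lam * charlier lam m z - (z : ℝ) * charlier lam m (z - 1) := by
  cases z with
  | zero => simp [charlier_zero_right]
  | succ z => simpa using charlier_succ_succ lam hl m z

theorem charlier_up_right (lam : ℝ) (hl : lam ≠ 0) (m z : ℕ) :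
    lam * charlier lam m (z + 1) =
      lam * charlier lam m z - (m : ℝ) * charlier lam (m - 1) z := by
  rw [charlier_symm lam m (z + 1), charlier_symm lam m z, charlier_symm lam (m - 1) z]
  exact charlier_up_left lam hl z m

theorem charlier_diff (lam : ℝ) (hl : lam ≠ 0) (m z : ℕ) :
    (z : ℝ) * charlier lam m (z - 1) - (m : ℝ) * charlier lam (m - 1) z =
      ((z : ℝ) - m) * charlier lam m z := by
  cases z with
  | zero => simp [charlier_zero_right]
  | succ z =>
    cases m with
    | zero =>
      simp [charlier]
    | succ m =>
      have hA := charlier_up_left lam hl m (z + 1)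
      have hB := charlier_up_right lam hl (m + 1) z
      simp only [Nat.add_sub_cancel] at *
      push_cast at *
      apply mul_left_cancel₀ hl
      linear_combination ((m : ℝ) + 1) * hA - ((z : ℝ) + 1) * hB

theorem charlier_edge (lam : ℝ) (hl : lam ≠ 0) (a b z w : ℕ) :
    (a : ℝ) * (charlier lam (a - 1) z * charlier lam (b + 1) w
        - charlier lam a z * charlier lam b w)
      + (b : ℝ) * (charlier lam (a + 1) z * charlier lam (b - 1) w
        - charlier lam a z * charlier lam b w) =
    (z : ℝ) * (charlier lam a (z - 1) * charlier lam b (w + 1)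
        - charlier lam a z * charlier lam b w)
      + (w : ℝ) * (charlier lam a (z + 1) * charlier lam b (w - 1)
        - charlier lam a z * charlier lam b w) := by
  have e1 := charlier_up_left lam hl a z
  have e2 := charlier_up_left lam hl b w
  have f1 := charlier_up_right lam hl a z
  have f2 := charlier_up_right lam hl b w
  have g1 := charlier_diff lam hl a z
  have g2 := charlier_diff lam hl b w
  apply mul_left_cancel₀ hl
  linear_combination (a : ℝ) * charlier lam (a - 1) z * e2 + (b : ℝ) * charlier lam (b - 1) w * e1
    - (z : ℝ) * charlier lam a (z - 1) * f2 - (w : ℝ) * charlier lam b (w - 1) * f1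
    - lam * charlier lam b w * g1 - lam * charlier lam a z * g2

theorem prod_split_pair {V : Type*} [Fintype V] [DecidableEq V] {n : ℕ}
    (g : V → Fin n → ℝ) (x y : V) (hxy : x ≠ y) (i : Fin n) :
    ∏ v, ∏ r, g v r = g x i * g y i *
      ∏ p ∈ (Finset.univ.erase (x, i)).erase (y, i), g p.1 p.2 := by
  rw [← Fintype.prod_prod_type' g, mul_assoc,
    Finset.mul_prod_erase _ (fun p : V × Fin n => g p.1 p.2) (a := (y, i))
      (by simp [hxy.symm]),
    Finset.mul_prod_erase _ (fun p : V × Fin n => g p.1 p.2) (a := (x, i)) (by simp)]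

theorem irwMove_src {V : Type*} [DecidableEq V] {n : ℕ} (ζ : V → Fin n → ℕ) (x y : V)
    (hxy : x ≠ y) (i : Fin n) : irwMove ζ x y i x i = ζ x i - 1 := by
  simp [irwMove, hxy]

theorem irwMove_tgt {V : Type*} [DecidableEq V] {n : ℕ} (ζ : V → Fin n → ℕ) (x y : V)
    (hxy : x ≠ y) (i : Fin n) : irwMove ζ x y i y i = ζ y i + 1 := by
  simp [irwMove, hxy.symm]

theorem irwMove_rest {V : Type*} [DecidableEq V] {n : ℕ} (ζ : V → Fin n → ℕ) (x y : V)
    (i : Fin n) (p : V × Fin n) (h1 : p ≠ (x, i)) (h2 : p ≠ (y, i)) :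
    irwMove ζ x y i p.1 p.2 = ζ p.1 p.2 := by
  have h1' : ¬ (p.1 = x ∧ p.2 = i) := fun h => h1 (Prod.ext h.1 h.2)
  have h2' : ¬ (p.1 = y ∧ p.2 = i) := fun h => h2 (Prod.ext h.1 h.2)
  simp [irwMove, h1', h2']

/-- Self-duality of the `n`-species IRW with respect to products of Charlier
polynomials: `[L D(·,η)](ξ) = [L D(ξ,·)](η)` for `D(ξ,η) = ∏_{x∈V} C(ξ^x,η^x,λ)`. -/
theorem irw_self_duality_charlier {V : Type*} [Fintype V] [DecidableEq V]
    (n : ℕ) (hn : 1 ≤ n) (lam : ℝ) (hlam : 0 < lam)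
    (E : Finset (V × V)) (hE : ∀ e ∈ E, e.1 ≠ e.2)
    (ξ η : V → Fin n → ℕ) :
    irwGen E (fun ξ' => ∏ x, charlierProd n lam (ξ' x) (η x)) ξ =
      irwGen E (fun η' => ∏ x, charlierProd n lam (ξ x) (η' x)) η := by
  unfold irwGen
  apply Finset.sum_congr rfl
  rintro ⟨x, y⟩ he
  have hxy : x ≠ y := hE _ he
  unfold irwEdge
  apply Finset.sum_congr rfl
  intro i _
  simp only [charlierProd]
  set R : ℝ := ∏ p ∈ (Finset.univ.erase (x, i)).erase (y, i),
    Real.exp lam * charlier lam (ξ p.1 p.2) (η p.1 p.2) with hR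
  have key : ∀ α β : V → Fin n → ℕ,
      (∀ p : V × Fin n, p ≠ (x, i) → p ≠ (y, i) →
        α p.1 p.2 = ξ p.1 p.2 ∧ β p.1 p.2 = η p.1 p.2) →
      ∏ v, ∏ r, Real.exp lam * charlier lam (α v r) (β v r) =
        Real.exp lam * charlier lam (α x i) (β x i) *
          (Real.exp lam * charlier lam (α y i) (β y i)) * R := by
    intro α β h
    rw [prod_split_pair (fun v r => Real.exp lam * charlier lam (α v r) (β v r)) x y hxy i, hR]
    congr 1
    apply Finset.prod_congr rfl
    intro p hp
    simp only [Finset.mem_erase, Finset.mem_univ, and_true] at hp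
    rw [(h p hp.2 hp.1).1, (h p hp.2 hp.1).2]
  rw [key ξ η (fun p _ _ => ⟨rfl, rfl⟩),
    key (irwMove ξ x y i) η (fun p h1 h2 => ⟨irwMove_rest ξ x y i p h1 h2, rfl⟩),
    key (irwMove ξ y x i) η (fun p h1 h2 => ⟨irwMove_rest ξ y x i p h2 h1, rfl⟩),
    key ξ (irwMove η x y i) (fun p h1 h2 => ⟨rfl, irwMove_rest η x y i p h1 h2⟩),
    key ξ (irwMove η y x i) (fun p h1 h2 => ⟨rfl, irwMove_rest η y x i p h2 h1⟩)]
  simp only [irwMove_src _ _ _ hxy, irwMove_tgt _ _ _ hxy, irwMove_src _ _ _ hxy.symm,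
    irwMove_tgt _ _ _ hxy.symm]
  linear_combination (Real.exp lam * Real.exp lam * R) *
    charlier_edge lam hlam.ne' (ξ x i) (ξ y i) (η x i) (η y i)
end
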